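/- arXiv:2605.03813 — 3 statements merged into one kernel-verified Lean document; each statement's English description precedes it below -/
import Mathlib

section
/- Let (R, m, k) be a commutative Noetherian local ring and let I be a proper ideal of R satisfying I ∩ m² = mI. If the quotient R/I has finite projective dimension as an R-module, then I is generated by an R-regular sequence. -/
open CategoryTheory IsLocalRing

/-- `M` has projective dimension at most `n` as an `R`-module: there is a projective
resolution of `M` that vanishes in degrees above `n`. -/
def HasProjDimLE (R : Type*) [Ring R] (M : Type*) [AddCommGroup M] [Module R M]
    (n : ℕ) : Prop :=
  ∃ P : ProjectiveResolution (ModuleCat.of R M),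
    ∀ i : ℕ, n < i → Limits.IsZero (P.complex.X i)

/-- `M` has finite projective dimension as an `R`-module. -/
def HasFiniteProjDim (R : Type*) [Ring R] (M : Type*) [AddCommGroup M] [Module R M] : Prop :=
  ∃ n : ℕ, HasProjDimLE R M n

/-- An ideal `I` of a local ring `(R, m)` is generated by an `R`-regular sequence:
a (possibly empty) list of elements of `m`, each a non-zerodivisor modulo its
predecessors, which generates `I`. -/
def IsGeneratedByRegularSequence (R : Type*) [CommRing R] [IsLocalRing R]
    (I : Ideal R) : Prop :=
  ∃ rs : List R, (∀ x ∈ rs, x ∈ maximalIdeal R) ∧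
    RingTheory.Sequence.IsWeaklyRegular R rs ∧ Ideal.span {x | x ∈ rs} = I

open TensorProduct Module

universe u

theorem HasFiniteProjDim.exists_hasProjectiveDimensionLT {R : Type u} [CommRing R]
    {M : Type u} [AddCommGroup M] [Module R M] (h : HasFiniteProjDim R M) :
    ∃ n : ℕ, HasProjectiveDimensionLT (ModuleCat.of R M) n := by
  obtain ⟨n, P, hP⟩ := h
  refine ⟨n + 1, HasProjectiveDimensionLT.mk fun i hi Y e ↦ ?_⟩
  obtain ⟨f, hf, rfl⟩ := P.extMk_surjective e (i + 1) rfl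
  obtain rfl : f = 0 := (hP i (by lia)).eq_of_src _ _
  exact P.extMk_zero _ _

namespace IsLocalRing

section

variable {R : Type*} [CommRing R] [IsLocalRing R] {M N : Type*} [AddCommGroup M] [Module R M]
  [AddCommGroup N] [Module R N]

theorem one_tmul_eq_zero_iff (v : M) :
    (1 : ResidueField R) ⊗ₜ[R] v = 0 ↔ v ∈ maximalIdeal R • (⊤ : Submodule R M) := by
  have h := quotTensorEquivQuotSMul_mk_tmul (maximalIdeal R) 1 v
  rw [one_smul] at h
  rw [← Submodule.Quotient.mk_eq_zero, ← h]
  exact ((quotTensorEquivQuotSMul M (maximalIdeal R)).map_eq_zero_iff).symm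

theorem lTensor_residueField_injective_of_forall (f : M →ₗ[R] N)
    (hf : ∀ v, f v ∈ maximalIdeal R • (⊤ : Submodule R N) →
      v ∈ maximalIdeal R • (⊤ : Submodule R M)) :
    Function.Injective (f.lTensor (ResidueField R)) := by
  rw [injective_iff_map_eq_zero]
  intro z hz
  obtain ⟨v, rfl⟩ := TensorProduct.mk_surjective R M (ResidueField R) residue_surjective z
  exact (one_tmul_eq_zero_iff v).2 (hf v ((one_tmul_eq_zero_iff _).1 hz))

end

section

variable {R : Type*} [CommRing R] {M ι : Type*} [AddCommGroup M] [Module R M]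

theorem _root_.Module.Basis.mem_ideal_smul_top_iff [Fintype ι] (b : Basis ι R M) (I : Ideal R)
    (v : M) : v ∈ I • (⊤ : Submodule R M) ↔ ∀ i, b.repr v i ∈ I := by
  refine ⟨fun h i ↦ ?_, fun h ↦ ?_⟩
  · refine Submodule.smul_induction_on h (fun r hr n _ ↦ ?_) fun x y hx hy ↦ ?_
    · simpa using I.mul_mem_right _ hr
    · simpa using I.add_mem hx hy
  · rw [← b.sum_repr v]
    exact Submodule.sum_mem _ fun i _ ↦ Submodule.smul_mem_smul (h i) trivial

end

section

variable {R : Type*} [CommRing R] [IsLocalRing R]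

/-- Every finite module over a local ring has a free cover with kernel inside `𝔪 • ⊤`. -/
theorem exists_minimal_generators (M : Type*) [AddCommGroup M] [Module R M] [Module.Finite R M] :
    ∃ (n : ℕ) (v : Fin n → M), Submodule.span R (Set.range v) = ⊤ ∧
      ∀ r : Fin n → R, ∑ i, r i • v i = 0 → ∀ i, r i ∈ maximalIdeal R := by
  let b := Module.finBasis (ResidueField R) (ResidueField R ⊗[R] M)
  choose v hv using fun i ↦
    TensorProduct.mk_surjective R M (ResidueField R) residue_surjective (b i)
  refine ⟨_, v, span_eq_top_of_tmul_eq_basis v b hv, fun r hr i ↦ ?_⟩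
  have h : ∑ i, residue R (r i) • b i = 0 := by
    have := congr_arg (TensorProduct.mk R (ResidueField R) M 1) hr
    rw [map_sum, map_zero] at this
    rw [← this]
    refine Finset.sum_congr rfl fun i _ ↦ ?_
    rw [map_smul, hv, ← algebraMap_smul (ResidueField R) (r i) (b i)]
    rfl
  exact (residue_eq_zero_iff _).1 (Fintype.linearIndependent_iff.1 b.linearIndependent _ h i)

/-- Over a local ring of depth zero, an injective map of finite free modules stays injective
modulo the maximal ideal. -/
theorem lTensor_residueField_injective_of_depth_zero {M N : Type*} [AddCommGroup M] [Module R M]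
    [AddCommGroup N] [Module R N] [Module.Free R M] [Module.Finite R M] (f : M →ₗ[R] N)
    (hf : Function.Injective f) {y : R} (hy : y ≠ 0) (hym : ∀ a ∈ maximalIdeal R, y * a = 0) :
    Function.Injective (f.lTensor (ResidueField R)) := by
  refine lTensor_residueField_injective_of_forall f fun v hv ↦ ?_
  have hz : ∀ w ∈ maximalIdeal R • (⊤ : Submodule R N), y • w = 0 := fun w hw ↦ by
    refine Submodule.smul_induction_on hw (fun r hr n _ ↦ ?_) fun a b ha hb ↦ ?_
    · rw [smul_smul, hym r hr, zero_smul]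
    · rw [smul_add, ha, hb, add_zero]
  have hyv : y • v = 0 := hf (by rw [map_smul, hz _ hv, map_zero])
  let b := Module.Free.chooseBasis R M
  refine (b.mem_ideal_smul_top_iff _ v).2 fun i hi ↦ hy ?_
  have h := congr_arg (fun w ↦ b.repr w i) hyv
  simp only [map_smul, Finsupp.smul_apply, smul_eq_mul, map_zero, Finsupp.coe_zero,
    Pi.zero_apply] at h
  exact (hi.mul_left_eq_zero).1 h

end

end IsLocalRing

theorem Module.finrank_eq_add_of_exact_of_free {R M N P : Type*} [CommRing R] [Nontrivial R]
    [AddCommGroup M] [Module R M] [AddCommGroup N] [Module R N] [AddCommGroup P] [Module R P]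
    [Module.Free R M] [Module.Finite R M] [Module.Free R P] [Module.Finite R P]
    {f : M →ₗ[R] N} {g : N →ₗ[R] P} (hf : Function.Injective f) (hfg : Function.Exact f g)
    (hg : Function.Surjective g) : finrank R N = finrank R M + finrank R P := by
  obtain ⟨l, hl⟩ := Module.projective_lifting_property g LinearMap.id hg
  rw [(hfg.splitSurjectiveEquiv hf ⟨l, hl⟩).1.finrank_eq, finrank_prod]

section LocalizedFree

variable {R : Type u} [CommRing R] [IsNoetherianRing R]

theorem exists_ne_zero_forall_mul_eq_zero_of_mem_associatedPrimes {q : Ideal R} [q.IsPrime]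
    (hq : q ∈ associatedPrimes R R) :
    ∃ y : Localization.AtPrime q, y ≠ 0 ∧
      ∀ a ∈ maximalIdeal (Localization.AtPrime q), y * a = 0 := by
  obtain ⟨x, hx⟩ := (isAssociatedPrime_iff.1 hq).2
  refine ⟨algebraMap R _ x, fun h ↦ ?_, fun a ha ↦ ?_⟩
  · obtain ⟨s, hs⟩ := (IsLocalization.map_eq_zero_iff q.primeCompl _ x).1 h
    exact s.2 (hx.ge (Submodule.mem_colon_singleton.2 hs))
  · rw [← Localization.AtPrime.map_eq_maximalIdeal] at ha
    refine Submodule.span_induction (p := fun a _ ↦ algebraMap R _ x * a = 0) ?_ (mul_zero _)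
      (fun a b _ _ ha hb ↦ by rw [mul_add, ha, hb, add_zero])
      (fun r a _ ha ↦ by rw [smul_eq_mul, mul_left_comm, ha, mul_zero]) ha
    rintro _ ⟨b, hb, rfl⟩
    rw [SetLike.mem_coe, hx, Submodule.mem_colon_singleton, Submodule.mem_bot] at hb
    rw [← map_mul, mul_comm, ← smul_eq_mul, hb, map_zero]

variable [IsLocalRing R]

theorem exists_finrank_localizedModule_eq (n : ℕ) (M : Type u) [AddCommGroup M] [Module R M]
    [Module.Finite R M] (h : HasProjectiveDimensionLT (ModuleCat.of R M) (n + 1)) :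
    ∃ r : ℕ, ∀ (q : Ideal R) [q.IsPrime], q ∈ associatedPrimes R R →
      Module.Free (Localization.AtPrime q) (LocalizedModule q.primeCompl M) ∧
      finrank (Localization.AtPrime q) (LocalizedModule q.primeCompl M) = r := by
  induction n generalizing M with
  | zero =>
    have : Module.Projective R M := (IsProjective.iff_projective M).2 inferInstance
    have : Module.Free R M := Module.free_of_flat_of_isLocalRing
    exact ⟨finrank R M, fun q _ _ ↦ ⟨free_of_isLocalizedModule q.primeCompl
        (LocalizedModule.mkLinearMap q.primeCompl M),
      finrank_of_isLocalizedModule_of_free _ q.primeCompl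
        (LocalizedModule.mkLinearMap q.primeCompl M)⟩⟩
  | succ n ih =>
    obtain ⟨F, _, _, _, _, f, hf⟩ := Module.exists_finite_presentation R M
    obtain ⟨r, hr⟩ := ih (LinearMap.ker f)
      (((LinearMap.shortExact_shortComplexKer hf).hasProjectiveDimensionLT_X₃_iff n
        ((IsProjective.iff_projective _).1 inferInstance)).1 h)
    refine ⟨finrank R F - r, fun q _ hq ↦ ?_⟩
    obtain ⟨_, hr⟩ := hr q hq
    obtain ⟨y, hy, hym⟩ := exists_ne_zero_forall_mul_eq_zero_of_mem_associatedPrimes hq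
    have : Module.Free (Localization.AtPrime q) (LocalizedModule q.primeCompl F) :=
      free_of_isLocalizedModule q.primeCompl
        (LocalizedModule.mkLinearMap q.primeCompl F)
    let i : LocalizedModule q.primeCompl (LinearMap.ker f) →ₗ[Localization.AtPrime q]
        LocalizedModule q.primeCompl F :=
      LocalizedModule.map q.primeCompl (LinearMap.ker f).subtype
    let g : LocalizedModule q.primeCompl F →ₗ[Localization.AtPrime q]
        LocalizedModule q.primeCompl M := LocalizedModule.map q.primeCompl f
    have hi : Function.Injective i :=
      LocalizedModule.map_injective q.primeCompl _ (Submodule.subtype_injective _)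
    have hs : Function.Surjective g := LocalizedModule.map_surjective q.primeCompl f hf
    have he : Function.Exact i g :=
      LocalizedModule.map_exact q.primeCompl _ _ f.exact_subtype_ker_map
    have hfree : Module.Free (Localization.AtPrime q) (LocalizedModule q.primeCompl M) :=
      free_of_lTensor_residueField_injective i g hs he
        (lTensor_residueField_injective_of_depth_zero i hi hy hym)
    refine ⟨hfree, ?_⟩
    have := finrank_eq_add_of_exact_of_free hi he hs
    rw [hr, finrank_of_isLocalizedModule_of_free _ q.primeCompl
      (LocalizedModule.mkLinearMap q.primeCompl F)] at this
    lia

theorem not_le_of_mem_associatedPrimes_of_hasProjectiveDimensionLT {I : Ideal R} (hI : I ≠ ⊥)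
    (n : ℕ) (h : HasProjectiveDimensionLT (ModuleCat.of R (R ⧸ I)) (n + 1)) :
    ∀ p ∈ associatedPrimes R R, ¬ I ≤ p := by
  intro p hp hIp
  obtain ⟨r, hr⟩ := exists_finrank_localizedModule_eq n (R ⧸ I) h
  have key (q : Ideal R) [q.IsPrime] (a : R) (ha : a ∈ I) :
      algebraMap R (Localization.AtPrime q) a ∈
        Module.annihilator (Localization.AtPrime q) (LocalizedModule q.primeCompl (R ⧸ I)) := by
    rw [Module.mem_annihilator]
    intro z
    induction z using LocalizedModule.induction_on with | h m s =>
    rw [algebraMap_smul, LocalizedModule.smul'_mk]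
    obtain ⟨m, rfl⟩ := Ideal.Quotient.mk_surjective m
    have : a • Ideal.Quotient.mk I m = 0 :=
      Ideal.Quotient.eq_zero_iff_mem.2 (I.mul_mem_right m ha)
    rw [this, LocalizedModule.zero_mk]
  have hr0 : r ≠ 0 := by
    have := hp.isPrime
    obtain ⟨_, hp'⟩ := hr p hp
    have : Nontrivial (LocalizedModule p.primeCompl (R ⧸ I)) := by
      rw [← not_subsingleton_iff_nontrivial, LocalizedModule.subsingleton_iff]
      intro hsub
      obtain ⟨s, hs, hs1⟩ := hsub (Ideal.Quotient.mk I 1)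
      have : s * 1 ∈ I := Ideal.Quotient.eq_zero_iff_mem.1 hs1
      exact hs (hIp (by simpa using this))
    rw [← hp']
    exact (finrank_pos_iff_of_free _ _).2 inferInstance |>.ne'
  obtain ⟨a, ha, ha0⟩ := Submodule.exists_mem_ne_zero_of_ne_bot hI
  obtain ⟨q, hq, haq⟩ := exists_le_isAssociatedPrime_of_isNoetherianRing R a ha0
  have := hq.isPrime
  obtain ⟨_, hq'⟩ := hr q hq
  have : Nontrivial (LocalizedModule q.primeCompl (R ⧸ I)) := by
    apply Module.nontrivial_of_finrank_pos (R := Localization.AtPrime q)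
    lia
  have h0 := key q a ha
  rw [Module.annihilator_eq_bot.2 inferInstance, Ideal.mem_bot,
    IsLocalization.map_eq_zero_iff q.primeCompl] at h0
  obtain ⟨s, hs⟩ := h0
  exact s.2 (haq (by simpa [mul_comm] using hs))

end LocalizedFree

section ChangeOfRings

variable {R : Type u} [CommRing R] [IsLocalRing R] [IsNoetherianRing R]

theorem exists_generators_dvd_of_hasProjectiveDimensionLT_two {x : R}
    (hx : x ∉ maximalIdeal R ^ 2) (M : Type u) [AddCommGroup M] [Module R M] [Module.Finite R M]
    (hM : ∀ v : M, x • v = 0) (h : HasProjectiveDimensionLT (ModuleCat.of R M) 2) :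
    ∃ (k : ℕ) (v : Fin k → M), Submodule.span R (Set.range v) = ⊤ ∧
      ∀ r : Fin k → R, ∑ i, r i • v i = 0 → ∀ i, x ∣ r i := by
  obtain ⟨k, v, hv, hmin⟩ := exists_minimal_generators (R := R) M
  refine ⟨k, v, hv, ?_⟩
  let f : (Fin k → R) →ₗ[R] M := Fintype.linearCombination R v
  have hf : Function.Surjective f := by
    rw [← LinearMap.range_eq_top, Fintype.range_linearCombination, hv]
  have hfr (r : Fin k → R) : f r = ∑ i, r i • v i := Fintype.linearCombination_apply R v r
  have : Module.Projective R (LinearMap.ker f) := by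
    have := ((LinearMap.shortExact_shortComplexKer hf).hasProjectiveDimensionLT_X₃_iff 0
      ((IsProjective.iff_projective _).1 inferInstance)).1 h
    rw [← projective_iff_hasProjectiveDimensionLT_one] at this
    exact (IsProjective.iff_projective _).2 this
  have : Module.Free R (LinearMap.ker f) := Module.free_of_flat_of_isLocalRing
  let φ : (Fin k → R) →ₗ[R] LinearMap.ker f :=
    (LinearMap.lsmul R (Fin k → R) x).codRestrict _ fun r ↦ by
      rw [LinearMap.mem_ker, LinearMap.lsmul_apply, map_smul, hM]
  have hφ (r : Fin k → R) : (φ r : Fin k → R) = x • r := rfl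
  obtain ⟨σ, hσ⟩ := (split_injective_iff_lTensor_residueField_injective φ).2 <|
    lTensor_residueField_injective_of_forall φ fun r hr ↦ by
      refine ((Pi.basisFun R (Fin k)).mem_ideal_smul_top_iff _ _).2 fun i ↦ ?_
      have key : ∀ w ∈ maximalIdeal R • (⊤ : Submodule R (LinearMap.ker f)),
          (w : Fin k → R) i ∈ maximalIdeal R ^ 2 := fun w hw ↦ by
        refine Submodule.smul_induction_on hw (fun a ha w _ ↦ ?_) fun a b ha hb ↦ ?_
        · rw [pow_two]
          exact Ideal.mul_mem_mul ha (hmin w ((hfr w).symm.trans w.2) i)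
        · exact Ideal.add_mem _ ha hb
      by_contra hri
      have hu : IsUnit (r i) := by simpa using hri
      have hxr : x * r i ∈ maximalIdeal R ^ 2 := key _ hr
      exact hx ((Ideal.mul_unit_mem_iff_mem _ hu).1 hxr)
  intro r hr i
  have h1 : φ r = x • (⟨r, (hfr r).trans hr⟩ : LinearMap.ker f) := Subtype.ext rfl
  have h2 : r = x • σ ⟨r, (hfr r).trans hr⟩ := by
    rw [← map_smul, ← h1]
    exact (LinearMap.congr_fun hσ r).symm
  exact ⟨_, congr_fun h2 i⟩

theorem hasProjectiveDimensionLT_two_pi_quotient_span_singleton {R : Type u} [CommRing R] {x : R}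
    (hx0 : x ∈ nonZeroDivisors R) (k : ℕ) :
    HasProjectiveDimensionLT (ModuleCat.of R (Fin k → R ⧸ Ideal.span {x})) 2 := by
  let a : (Fin k → R) →ₗ[R] (Fin k → R) := LinearMap.lsmul R (Fin k → R) x
  let b : (Fin k → R) →ₗ[R] (Fin k → R ⧸ Ideal.span {x}) :=
    (Algebra.linearMap R (R ⧸ Ideal.span {x})).compLeft (Fin k)
  have ha : Function.Injective a := (injective_iff_map_eq_zero a).2 fun r hr ↦ funext fun i ↦
    (mem_nonZeroDivisors_iff.1 hx0).1 _ (congr_fun hr i)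
  have hb : Function.Surjective b := fun r ↦ by
    choose r' hr' using fun i ↦ Ideal.Quotient.mk_surjective (r i)
    exact ⟨r', funext hr'⟩
  have hab : Function.Exact a b := fun r ↦ by
    refine ⟨fun hr ↦ ?_, ?_⟩
    · choose c hc using fun i ↦ Ideal.mem_span_singleton.1
        (Ideal.Quotient.eq_zero_iff_mem.1 (congr_fun hr i))
      exact ⟨c, funext fun i ↦ (hc i).symm⟩
    · rintro ⟨c, rfl⟩
      exact funext fun i ↦ Ideal.Quotient.eq_zero_iff_mem.2
        (Ideal.mem_span_singleton.2 (dvd_mul_right x (c i)))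
  have hP : Projective (ModuleCat.of R (Fin k → R)) :=
    (IsProjective.iff_projective _).1 inferInstance
  exact (ModuleCat.shortComplex_shortExact
    (ModuleCat.shortComplexOfCompEqZero a b hab.linearMap_comp_eq_zero) hab ha
      hb).hasProjectiveDimensionLT_X₃ 1 (inferInstanceAs (HasProjectiveDimensionLT
        (ModuleCat.of R (Fin k → R)) 1)) (inferInstanceAs (HasProjectiveDimensionLT
        (ModuleCat.of R (Fin k → R)) 2))

/-- Over the hypersurface ring `R ⧸ (x)`, `x ∉ 𝔪 ^ 2`, projective dimension drops by at least
one. -/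
theorem hasProjectiveDimensionLT_quotient_span_singleton {x : R} (hx0 : x ∈ nonZeroDivisors R)
    (hx : x ∉ maximalIdeal R ^ 2) (n : ℕ) (M : Type u) [AddCommGroup M] [Module R M]
    [Module (R ⧸ Ideal.span {x}) M] [IsScalarTower R (R ⧸ Ideal.span {x}) M] [Module.Finite R M]
    (h : HasProjectiveDimensionLT (ModuleCat.of R M) (n + 2)) :
    HasProjectiveDimensionLT (ModuleCat.of (R ⧸ Ideal.span {x}) M) (n + 1) := by
  induction n generalizing M with
  | zero =>
    have hxS : algebraMap R (R ⧸ Ideal.span {x}) x = 0 :=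
      Ideal.Quotient.eq_zero_iff_mem.2 (Ideal.mem_span_singleton_self x)
    have hM (v : M) : x • v = 0 := by
      rw [← algebraMap_smul (R ⧸ Ideal.span {x}) x v, hxS, zero_smul]
    obtain ⟨k, v, hv, hd⟩ := exists_generators_dvd_of_hasProjectiveDimensionLT_two hx M hM h
    have hli : LinearIndependent (R ⧸ Ideal.span {x}) v := by
      refine Fintype.linearIndependent_iff.2 fun g hg i ↦ ?_
      choose r hr using fun i ↦ Ideal.Quotient.mk_surjective (g i)
      rw [← hr i, Ideal.Quotient.eq_zero_iff_mem, Ideal.mem_span_singleton]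
      refine hd r ?_ i
      rw [← hg]
      refine Finset.sum_congr rfl fun i _ ↦ ?_
      rw [← hr i]
      exact (algebraMap_smul (R ⧸ Ideal.span {x}) (r i) (v i)).symm
    have hsp : ⊤ ≤ Submodule.span (R ⧸ Ideal.span {x}) (Set.range v) := fun m _ ↦
      Submodule.span_le_restrictScalars R (R ⧸ Ideal.span {x}) _ (hv ▸ Submodule.mem_top)
    have : Module.Free (R ⧸ Ideal.span {x}) M := Module.Free.of_basis (Basis.mk hli hsp)
    have : Projective (ModuleCat.of (R ⧸ Ideal.span {x}) M) :=
      (IsProjective.iff_projective M).1 inferInstance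
    exact inferInstance
  | succ n ih =>
    have : Module.Finite (R ⧸ Ideal.span {x}) M :=
      Module.Finite.of_restrictScalars_finite R (R ⧸ Ideal.span {x}) M
    obtain ⟨k, f, hf⟩ := Module.Finite.exists_fin' (R ⧸ Ideal.span {x}) M
    have hS := (LinearMap.shortExact_shortComplexKer hf).hasProjectiveDimensionLT_X₃_iff n
        ((IsProjective.iff_projective _).1 inferInstance)
    have : Module.Finite R (LinearMap.ker f) := Module.Finite.trans (R ⧸ Ideal.span {x}) _
    refine hS.2 (ih (LinearMap.ker f) ?_)
    have he : Function.Exact ((LinearMap.ker f).subtype.restrictScalars R) (f.restrictScalars R) :=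
      f.exact_subtype_ker_map
    have : HasProjectiveDimensionLT (ModuleCat.of R (Fin k → R ⧸ Ideal.span {x})) 2 :=
      hasProjectiveDimensionLT_two_pi_quotient_span_singleton hx0 k
    exact (ModuleCat.shortComplex_shortExact (ModuleCat.shortComplexOfCompEqZero _ _
      he.linearMap_comp_eq_zero) he (Submodule.subtype_injective _) hf).hasProjectiveDimensionLT_X₁
        (n + 2) (hasProjectiveDimensionLT_of_ge _ 2 _ (by lia)) h

end ChangeOfRings

section RegularSequence

open scoped Pointwise

theorem isWeaklyRegular_cons_of_quotient_span_singleton {R : Type*} [CommRing R] {x : R}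
    (hx : x ∈ nonZeroDivisors R) {rs : List R}
    (h : RingTheory.Sequence.IsWeaklyRegular (R ⧸ Ideal.span {x})
      (rs.map (Ideal.Quotient.mk (Ideal.span {x})))) :
    RingTheory.Sequence.IsWeaklyRegular R (x :: rs) := by
  refine (RingTheory.Sequence.isWeaklyRegular_cons_iff R x rs).2 ⟨?_, ?_⟩
  · exact isSMulRegular_iff_right_eq_zero_of_smul.2 (mem_nonZeroDivisors_iff.1 hx).1
  · have hxt : x • (⊤ : Submodule R R) = Ideal.span {x} := by
      rw [← Submodule.ideal_span_singleton_smul, smul_eq_mul, Ideal.mul_top]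
    exact ((Submodule.quotEquivOfEq _ _ hxt).isWeaklyRegular_congr rs).2
      ((RingTheory.Sequence.isWeaklyRegular_map_algebraMap_iff (S := R ⧸ Ideal.span {x}) _ rs).1 h)

variable {R : Type u} [CommRing R] [IsLocalRing R]

theorem map_mk_inf_maximalIdeal_sq_eq {I : Ideal R} {x : R} (hxI : x ∈ I)
    [IsLocalRing (R ⧸ Ideal.span {x})]
    (hIm : I ⊓ maximalIdeal R ^ 2 = maximalIdeal R * I) :
    I.map (Ideal.Quotient.mk (Ideal.span {x})) ⊓ maximalIdeal (R ⧸ Ideal.span {x}) ^ 2 =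
      maximalIdeal (R ⧸ Ideal.span {x}) * I.map (Ideal.Quotient.mk (Ideal.span {x})) := by
  have hs : Function.Surjective (Ideal.Quotient.mk (Ideal.span {x})) :=
    Ideal.Quotient.mk_surjective
  rw [← map_maximalIdeal_of_surjective _ hs, ← Ideal.map_pow, ← Ideal.map_mul, ← hIm]
  refine le_antisymm (fun z hz ↦ ?_) (Ideal.map_inf_le _)
  obtain ⟨a, ha, rfl⟩ := (Ideal.mem_map_iff_of_surjective _ hs).1 hz.1
  obtain ⟨b, hb, hab⟩ := (Ideal.mem_map_iff_of_surjective _ hs).1 hz.2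
  rw [← hab]
  refine Ideal.mem_map_of_mem _ ⟨?_, hb⟩
  have : b - a ∈ I :=
    (Ideal.span_singleton_le_iff_mem I).2 hxI (Ideal.Quotient.eq.1 hab)
  simpa using I.add_mem this ha

theorem IsGeneratedByRegularSequence.of_quotient_span_singleton {I : Ideal R} {x : R}
    (hxI : x ∈ I) (hxm : x ∈ maximalIdeal R) (hx0 : x ∈ nonZeroDivisors R)
    [IsLocalRing (R ⧸ Ideal.span {x})]
    (h : IsGeneratedByRegularSequence (R ⧸ Ideal.span {x})
      (I.map (Ideal.Quotient.mk (Ideal.span {x})))) :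
    IsGeneratedByRegularSequence R I := by
  obtain ⟨rs, hm, hreg, hspan⟩ := h
  have hs : Function.Surjective (Ideal.Quotient.mk (Ideal.span {x})) :=
    Ideal.Quotient.mk_surjective
  obtain ⟨rs, rfl⟩ := (List.map_surjective_iff.2 hs) rs
  have hloc : IsLocalHom (Ideal.Quotient.mk (Ideal.span {x})) := .of_surjective _ hs
  refine ⟨x :: rs, ?_, isWeaklyRegular_cons_of_quotient_span_singleton hx0 hreg, ?_⟩
  · rintro y hy
    obtain rfl | hy := List.mem_cons.1 hy
    · exact hxm
    · rw [← maximalIdeal_comap (Ideal.Quotient.mk (Ideal.span {x}))]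
      exact hm _ (List.mem_map_of_mem hy)
  · change Ideal.ofList (x :: rs) = I
    change Ideal.ofList (rs.map _) = _ at hspan
    rw [← Ideal.map_ofList] at hspan
    have := congr_arg (Ideal.comap (Ideal.Quotient.mk (Ideal.span {x}))) hspan
    rw [Ideal.comap_map_of_surjective' _ hs, Ideal.comap_map_of_surjective' _ hs,
      Ideal.mk_ker] at this
    rw [Ideal.ofList_cons, sup_comm, this,
      sup_eq_left.2 ((Ideal.span_singleton_le_iff_mem I).2 hxI)]

variable [IsNoetherianRing R]

theorem exists_mem_nonZeroDivisors_notMem_maximalIdeal_mul {I : Ideal R} (hI : I ≠ ⊥)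
    (h : ∀ p ∈ associatedPrimes R R, ¬ I ≤ p) :
    ∃ x ∈ I, x ∈ nonZeroDivisors R ∧ x ∉ maximalIdeal R * I := by
  by_contra! hcon
  have hsub : (I : Set R) ⊆
      ⋃ p ∈ insert (maximalIdeal R * I) (associatedPrimes R R), ((id p : Ideal R) : Set R) := by
    intro x hx
    rw [Set.biUnion_insert]
    by_cases hx0 : x ∈ nonZeroDivisors R
    · exact Or.inl (hcon x hx hx0)
    · right
      have : x ∈ (nonZeroDivisors R : Set R)ᶜ := hx0
      rwa [← biUnion_associatedPrimes_eq_compl_nonZeroDivisors] at this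
  obtain ⟨p, hp, hIp⟩ := (Ideal.subset_union_prime_finite ((associatedPrimes.finite R R).insert _)
    (maximalIdeal R * I) (maximalIdeal R * I)
    fun p hp hne _ ↦ (hp.resolve_left hne).isPrime).1 hsub
  obtain rfl | hp := hp
  · exact hI (Submodule.eq_bot_of_le_smul_of_le_jacobson_bot _ _ (IsNoetherian.noetherian I) hIp
      (maximalIdeal_le_jacobson _))
  · exact h p hp hIp

theorem exists_hasProjectiveDimensionLT_quotient_map_mk {I : Ideal R} {x : R} (hxI : x ∈ I)
    (hx0 : x ∈ nonZeroDivisors R) (hx : x ∉ maximalIdeal R ^ 2)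
    (h : ∃ n : ℕ, HasProjectiveDimensionLT (ModuleCat.of R (R ⧸ I)) n) :
    ∃ n : ℕ, HasProjectiveDimensionLT (ModuleCat.of (R ⧸ Ideal.span {x})
      ((R ⧸ Ideal.span {x}) ⧸ I.map (Ideal.Quotient.mk (Ideal.span {x})))) n := by
  obtain ⟨n, h⟩ := h
  refine ⟨n + 1, hasProjectiveDimensionLT_quotient_span_singleton hx0 hx n _ ?_⟩
  have := hasProjectiveDimensionLT_of_ge (ModuleCat.of R (R ⧸ I)) n (n + 2) (by lia)
  exact hasProjectiveDimensionLT_of_iso (LinearEquiv.toModuleIso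
    (DoubleQuot.quotQuotEquivQuotOfLEₐ R
      ((Ideal.span_singleton_le_iff_mem I).2 hxI)).symm.toLinearEquiv) _

end RegularSequence

theorem isGeneratedByRegularSequence_of_ringKrullDim_add_one_le (d : ℕ) {R : Type u} [CommRing R]
    [IsLocalRing R] [IsNoetherianRing R] (hd : ringKrullDim R + 1 ≤ d) {I : Ideal R} (hI : I ≠ ⊤)
    (hIm : I ⊓ maximalIdeal R ^ 2 = maximalIdeal R * I)
    (hpd : ∃ n : ℕ, HasProjectiveDimensionLT (ModuleCat.of R (R ⧸ I)) n) :
    IsGeneratedByRegularSequence R I := by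
  induction d generalizing R with
  | zero => exact absurd ((ENat.WithBot.add_one_le_zero_iff _).1 (mod_cast hd)) ringKrullDim_ne_bot
  | succ d ih =>
    by_cases hI0 : I = ⊥
    · exact ⟨[], by simp, .nil R R, by simp [hI0]⟩
    obtain ⟨x, hxI, hx0, hxmI⟩ := exists_mem_nonZeroDivisors_notMem_maximalIdeal_mul hI0 <| by
      obtain ⟨n, h⟩ := hpd
      exact not_le_of_mem_associatedPrimes_of_hasProjectiveDimensionLT hI0 n
        (hasProjectiveDimensionLT_of_ge _ n _ (by lia))
    have hx : x ∉ maximalIdeal R ^ 2 := fun hx ↦ hxmI (hIm ▸ ⟨hxI, hx⟩)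
    have hxm : x ∈ maximalIdeal R := le_maximalIdeal hI hxI
    have hs : Ideal.span {x} ≠ ⊤ := fun h ↦
      (mem_maximalIdeal x).1 hxm (Ideal.span_singleton_eq_top.1 h)
    have : Nontrivial (R ⧸ Ideal.span {x}) := Ideal.Quotient.nontrivial_iff.2 hs
    have : IsLocalRing (R ⧸ Ideal.span {x}) :=
      .of_surjective' (Ideal.Quotient.mk _) Ideal.Quotient.mk_surjective
    refine .of_quotient_span_singleton hxI hxm hx0 (ih ?_ ?_ (map_mk_inf_maximalIdeal_sq_eq hxI hIm)
      (exists_hasProjectiveDimensionLT_quotient_map_mk hxI hx0 hx hpd))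
    · refine (ringKrullDim_quotient_succ_le_of_nonZeroDivisor hx0).trans ?_
      exact ENat.WithBot.add_le_add_one_right_iff.1 (mod_cast hd)
    · rw [← Ideal.Quotient.nontrivial_iff]
      have := Ideal.Quotient.nontrivial_iff.2 hI
      exact (DoubleQuot.quotQuotEquivQuotOfLE
        ((Ideal.span_singleton_le_iff_mem I).2 hxI)).toEquiv.nontrivial

/-- If `(R, m, k)` is a commutative Noetherian local ring and `I` a proper ideal with
`I ∩ m² = mI`, and `R/I` has finite projective dimension over `R`, then `I` is
generated by an `R`-regular sequence. -/
theorem stmt0 (R : Type*) [CommRing R] [IsLocalRing R] [IsNoetherianRing R]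
    (I : Ideal R) (hI : I ≠ ⊤)
    (hIm : I ⊓ (maximalIdeal R) ^ 2 = maximalIdeal R * I)
    (hpd : HasFiniteProjDim R (R ⧸ I)) :
    IsGeneratedByRegularSequence R I := by
  obtain ⟨d, hd⟩ : ∃ d : ℕ, ringKrullDim R + 1 ≤ d := by
    obtain ⟨e, he⟩ := WithBot.ne_bot_iff_exists.1 (ringKrullDim_ne_bot (R := R))
    have he' : e ≠ ⊤ := by
      rintro rfl
      exact ringKrullDim_ne_top (R := R) he.symm
    obtain ⟨d, rfl⟩ := ENat.ne_top_iff_exists.1 he'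
    exact ⟨d + 1, by rw [← he]; norm_cast⟩
  exact isGeneratedByRegularSequence_of_ringKrullDim_add_one_le d hd hI hIm
    hpd.exists_hasProjectiveDimensionLT
end

section
/- Let (R, m, k) be a commutative Noetherian local ring that is not a field, and let I be a nonzero ideal of R contained in the socle (0 :_R m) of R such that I ∩ m² = mI. Then R/I has infinite projective dimension as an R-module. -/
open CategoryTheory IsLocalRing

/-- A resolution vanishing in degrees above `n` bounds Mathlib's projective dimension by `n`. -/
theorem HasProjDimLE.hasProjectiveDimensionLE {R : Type*} [Ring R] {M : Type*} [AddCommGroup M]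
    [Module R M] {n : ℕ} (h : HasProjDimLE R M n) :
    HasProjectiveDimensionLE (ModuleCat.of R M) n := by
  obtain ⟨P, hP⟩ := h
  let := HasExt.standard (ModuleCat R)
  refine HasProjectiveDimensionLT.mk fun i hi Y e ↦ ?_
  obtain ⟨f, hf, rfl⟩ := P.extMk_surjective e (i + 1) rfl
  obtain rfl : f = 0 := (hP i hi).eq_of_src _ _
  exact P.extMk_zero (i + 1) rfl

/-- A finitely generated module over a local ring has a finite free cover whose kernel has all
its coordinates in the maximal ideal. -/
theorem exists_minimal_free_cover (R : Type*) [CommRing R] [IsLocalRing R] (M : Type*)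
    [AddCommGroup M] [Module R M] [Module.Finite R M] :
    ∃ (n : ℕ) (f : (Fin n →₀ R) →ₗ[R] M), Function.Surjective f ∧
      ∀ x, f x = 0 → ∀ i, x i ∈ maximalIdeal R := by
  let b := Module.finBasis (ResidueField R) (TensorProduct R (ResidueField R) M)
  choose v hv using fun i ↦
    TensorProduct.mk_surjective R M (ResidueField R) Ideal.Quotient.mk_surjective (b i)
  refine ⟨_, Finsupp.linearCombination R v, ?_, fun x hx i ↦ ?_⟩
  · rw [← LinearMap.range_eq_top, Finsupp.range_linearCombination]
    exact span_eq_top_of_tmul_eq_basis v b hv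
  · rw [← residue_eq_zero_iff]
    have h := congrArg (TensorProduct.mk R (ResidueField R) M 1) hx
    rw [Finsupp.linearCombination_apply, Finsupp.sum_fintype _ _ (by simp), map_sum, map_zero] at h
    simp only [map_smul, hv] at h
    exact Fintype.linearIndependent_iff.mp b.linearIndependent (fun j ↦ residue R (x j)) h i

/-- Over a Noetherian local ring of depth zero, finitely generated modules of finite projective
dimension are projective. -/
theorem projective_of_hasProjectiveDimensionLE.{u} {R : Type u} [CommRing R] [IsLocalRing R]
    [IsNoetherianRing R] {s : R} (hs : s ≠ 0) (hsm : ∀ y ∈ maximalIdeal R, s * y = 0)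
    (n : ℕ) (M : ModuleCat.{u} R) [Module.Finite R M] (h : HasProjectiveDimensionLE M n) :
    Module.Projective R M := by
  induction n generalizing M with
  | zero =>
    exact (IsProjective.iff_projective M).mpr
      ((projective_iff_hasProjectiveDimensionLE_zero _).mpr h)
  | succ n ih =>
    obtain ⟨d, f, hf, hker⟩ := exists_minimal_free_cover R M
    have hS := LinearMap.shortExact_shortComplexKer hf
    have : Module.Projective R f.ker :=
      ih (ModuleCat.of R f.ker) ((hS.hasProjectiveDimensionLT_X₃_iff n
        (ModuleCat.projective_of_free (Module.Free.chooseBasis R (Fin d →₀ R)))).mp h)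
    have : Module.Free R f.ker := Module.free_of_flat_of_isLocalRing (R := R) (P := f.ker)
    have hsub : Subsingleton f.ker := by
      by_contra! hn
      have hmem : s ∈ Module.annihilator R f.ker := Module.mem_annihilator.mpr fun x ↦
        Subtype.ext (Finsupp.ext fun i ↦ hsm _ (hker x x.2 i))
      rw [(Module.annihilator_eq_bot (R := R) (M := f.ker)).mpr inferInstance] at hmem
      exact hs hmem
    exact Module.Projective.of_equiv (LinearEquiv.ofBijective f
      ⟨LinearMap.ker_eq_bot.mp (Submodule.subsingleton_iff_eq_bot.mp hsub), hf⟩)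

/-- If `(R, m, k)` is a commutative Noetherian local ring which is not a field and `I`
is a nonzero ideal contained in the socle `(0 :_R m)` with `I ∩ m² = mI`, then `R/I`
has infinite projective dimension as an `R`-module. -/
theorem stmt2 (R : Type*) [CommRing R] [IsLocalRing R] [IsNoetherianRing R]
    (hR : ¬ IsField R) (I : Ideal R) (hI : I ≠ ⊥)
    (hsoc : ∀ x ∈ I, ∀ y ∈ maximalIdeal R, x * y = 0)
    (hIm : I ⊓ (maximalIdeal R) ^ 2 = maximalIdeal R * I) :
    ¬ HasFiniteProjDim R (R ⧸ I) := by
  rintro ⟨n, hn⟩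
  obtain ⟨s, hsI, hs⟩ := Submodule.exists_mem_ne_zero_of_ne_bot hI
  have : Module.Projective R (R ⧸ I) := projective_of_hasProjectiveDimensionLE hs (hsoc s hsI) n
    (ModuleCat.of R (R ⧸ I)) hn.hasProjectiveDimensionLE
  have : Module.Free R (R ⧸ I) := Module.free_of_flat_of_isLocalRing
  have hItop : I ≠ ⊤ := fun h ↦ hR <| isField_iff_maximalIdeal_eq.mpr <|
    (Submodule.eq_bot_iff _).mpr fun y hy ↦ by
      simpa using hsoc 1 (h ▸ Submodule.mem_top) y hy
  have : Nontrivial (R ⧸ I) := Ideal.Quotient.nontrivial_iff.mpr hItop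
  apply hI
  rw [← Ideal.annihilator_quotient (I := I), Module.annihilator_eq_bot.mpr inferInstance]
end

section
/- Let (R, m, k) be a commutative Noetherian local ring whose maximal ideal decomposes as an internal direct sum m = I ⊕ J of two ideals (that is, I + J = m and I ∩ J = 0), where I is a nonzero ideal that is not generated by any R-regular sequence. Then R/I has infinite projective dimension as an R-module. -/
open CategoryTheory IsLocalRing

universe u

section ModuleProjectiveDimension

variable {R : Type u} [CommRing R]

/-- Projective dimension at most `n`, for unbundled modules. -/
abbrev PDLE (R : Type u) [CommRing R] (M : Type u) [AddCommGroup M] [Module R M] (n : ℕ) : Prop :=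
  HasProjectiveDimensionLE (ModuleCat.of R M) n

variable {M N P : Type u} [AddCommGroup M] [Module R M] [AddCommGroup N] [Module R N]
  [AddCommGroup P] [Module R P]

lemma pdLE_zero_iff : PDLE R M 0 ↔ Module.Projective R M := by
  rw [PDLE, ← projective_iff_hasProjectiveDimensionLE_zero, ← IsProjective.iff_projective]

lemma PDLE.succ {n : ℕ} (h : PDLE R M n) : PDLE R M (n + 1) :=
  hasProjectiveDimensionLT_of_ge _ (n + 1) (n + 2) (by omega)

lemma pdLE_succ_iff [Module.Projective R P] (f : P →ₗ[R] M) (hf : Function.Surjective f) (n : ℕ) :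
    PDLE R M (n + 1) ↔ PDLE R (LinearMap.ker f) n :=
  (LinearMap.shortExact_shortComplexKer hf).hasProjectiveDimensionLT_X₃_iff n
    ((IsProjective.iff_projective P).mp ‹_›)

lemma PDLE.of_retract {n : ℕ} (h : PDLE R N n) (i : M →ₗ[R] N) (p : N →ₗ[R] M)
    (hpi : ∀ m, p (i m) = m) : PDLE R M n := by
  have : HasProjectiveDimensionLE (ModuleCat.of R N) n := h
  refine Retract.hasProjectiveDimensionLT (Y := ModuleCat.of R N)
    ⟨ModuleCat.ofHom i, ModuleCat.ofHom p, ?_⟩ (n + 1)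
  ext m
  exact hpi m

lemma HasFiniteProjDim.exists_pdLE (h : HasFiniteProjDim R M) : ∃ n, PDLE R M n := by
  obtain ⟨n, Q, hQ⟩ := h
  refine ⟨n, (hasProjectiveDimensionLT_iff _ _).mpr fun i hi Y e ↦ ?_⟩
  obtain ⟨f, hf, rfl⟩ := Q.extMk_surjective e (i + 1) rfl
  obtain rfl : f = 0 := (hQ i hi).eq_of_src _ _
  simp

lemma LinearMap.exists_comp_eq_of_ker_le (q : M →ₗ[R] N) (hq : Function.Surjective q)
    (h : M →ₗ[R] P) (hk : ∀ m, q m = 0 → h m = 0) : ∃ g : N →ₗ[R] P, ∀ m, g (q m) = h m := by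
  refine ⟨((LinearMap.ker q).liftQ h hk) ∘ₗ (q.quotKerEquivOfSurjective hq).symm, fun m ↦ ?_⟩
  have : (q.quotKerEquivOfSurjective hq).symm (q m) = Submodule.Quotient.mk m := by
    rw [LinearEquiv.symm_apply_eq]; rfl
  simpa [this] using (LinearMap.ker q).liftQ_apply h m

end ModuleProjectiveDimension

section Quotient

variable {R A : Type u} [CommRing R] [CommRing A] [Algebra R A]

/-- If `x` is regular on `R` and `M`, passing to `M / xM` over `R / x` does not increase the
projective dimension. -/
lemma PDLE.of_quotient_regular (hA : Function.Surjective (algebraMap R A)) (x : R)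
    (hxA : ∀ r, algebraMap R A r = 0 ↔ ∃ s, r = x * s) (hxR : IsSMulRegular R x)
    {M N : Type u} [AddCommGroup M] [Module R M] [AddCommGroup N] [Module R N] [Module A N]
    [IsScalarTower R A N] (q : M →ₗ[R] N) (hq : Function.Surjective q)
    (hqx : ∀ m, q m = 0 ↔ ∃ m', m = x • m') (hxM : IsSMulRegular M x)
    {n : ℕ} (h : PDLE R M n) : PDLE A N n := by
  classical
  let f : (M →₀ R) →ₗ[R] M := Finsupp.linearCombination R id
  let f' : (M →₀ A) →ₗ[A] N := Finsupp.linearCombination A q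
  let π : (M →₀ R) →ₗ[R] (M →₀ A) := Finsupp.mapRange.linearMap (Algebra.linearMap R A)
  have hf : Function.Surjective f := fun m ↦ ⟨Finsupp.single m 1, by simp [f]⟩
  have hf' : Function.Surjective f' := fun y ↦ by
    obtain ⟨m, rfl⟩ := hq y
    exact ⟨Finsupp.single m 1, by simp [f']⟩
  have hπ : Function.Surjective π := Finsupp.mapRange_surjective _ (map_zero _) hA
  have hcomm : ∀ v, f' (π v) = q (f v) := fun v ↦ by
    induction v using Finsupp.induction_linear with
    | zero => simp
    | add v w hv hw => simp only [map_add, hv, hw]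
    | single m r => simp [f, f', π]
  have hπx : ∀ v, π v = 0 → ∃ w, v = x • w := fun v hv ↦ by
    have hd : ∀ r : R, ∃ s, (algebraMap R A r = 0 → r = x * s) ∧ (r = 0 → s = 0) := fun r ↦ by
      by_cases h0 : r = 0
      · exact ⟨0, by simp [h0]⟩
      by_cases hr : algebraMap R A r = 0
      · obtain ⟨s, hs⟩ := (hxA r).mp hr
        exact ⟨s, fun _ ↦ hs, fun h ↦ absurd h h0⟩
      · exact ⟨0, fun h ↦ absurd h hr, fun _ ↦ rfl⟩
    choose d hd hd0 using hd
    refine ⟨v.mapRange d (hd0 0 rfl), ?_⟩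
    ext i
    simpa using hd (v i) (DFunLike.congr_fun hv i)
  have hx0 : algebraMap R A x = 0 := (hxA x).mpr ⟨1, (mul_one x).symm⟩
  have hπ0 : ∀ w, π (x • w) = 0 := fun w ↦ by
    rw [map_smul, ← algebraMap_smul A x, hx0, zero_smul]
  cases n with
  | zero =>
    have := pdLE_zero_iff.mp h
    obtain ⟨s, hs⟩ := Module.projective_lifting_property f LinearMap.id hf
    obtain ⟨g, hg⟩ := LinearMap.exists_comp_eq_of_ker_le q hq (π ∘ₗ s) (fun m hm ↦ by
      obtain ⟨m', rfl⟩ := (hqx m).mp hm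
      rw [LinearMap.comp_apply, map_smul, hπ0])
    refine pdLE_zero_iff.mpr (Module.Projective.of_split
      (g.extendScalarsOfSurjective hA) f' (LinearMap.ext fun y ↦ ?_))
    obtain ⟨m, rfl⟩ := hq y
    change f' (g (q m)) = q m
    rw [hg, LinearMap.comp_apply, hcomm]
    exact congrArg q (LinearMap.congr_fun hs m)
  | succ n =>
    rw [pdLE_succ_iff f hf] at h
    rw [pdLE_succ_iff f' hf']
    let q' : LinearMap.ker f →ₗ[R] LinearMap.ker f' :=
      { toFun := fun v ↦ ⟨π v, by rw [LinearMap.mem_ker, hcomm, v.2, map_zero]⟩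
        map_add' := fun v w ↦ Subtype.ext (map_add π _ _)
        map_smul' := fun r v ↦ Subtype.ext (map_smul π _ _) }
    refine PDLE.of_quotient_regular hA x hxA hxR q' ?_ ?_ ?_ h
    · rintro ⟨y, hy⟩
      obtain ⟨v, rfl⟩ := hπ y
      rw [LinearMap.mem_ker, hcomm, hqx] at hy
      obtain ⟨m', hm'⟩ := hy
      obtain ⟨w, rfl⟩ := hf m'
      refine ⟨⟨v - x • w, by rw [LinearMap.mem_ker, map_sub, map_smul, hm', sub_self]⟩,
        Subtype.ext ?_⟩
      change π (v - x • w) = π v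
      rw [map_sub, hπ0, sub_zero]
    · rintro ⟨v, hv⟩
      refine ⟨fun h0 ↦ ?_, fun ⟨w, hw⟩ ↦ Subtype.ext ?_⟩
      · obtain ⟨w, rfl⟩ := hπx v (congrArg Subtype.val h0)
        rw [LinearMap.mem_ker, map_smul] at hv
        exact ⟨⟨w, hxM (by simpa using hv)⟩, rfl⟩
      · change π v = 0
        rw [show v = x • (w : M →₀ R) from congrArg Subtype.val hw, hπ0]
    · intro v w hvw
      ext i
      exact hxR (DFunLike.congr_fun (congrArg Subtype.val hvw) i)

end Quotient

/-- An internal direct sum decomposition `m = I ⊕ J` gives a linear projection of `m` onto `J`. -/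
lemma exists_projection {R : Type u} [CommRing R] {m I J : Ideal R}
    (hsup : I ⊔ J = m) (hinf : I ⊓ J = ⊥) :
    ∃ p : m →ₗ[R] J, ∀ (j : J) (hj : (j : R) ∈ m), p ⟨j, hj⟩ = j := by
  have hI : I ≤ m := hsup ▸ le_sup_left
  have hJ : J ≤ m := hsup ▸ le_sup_right
  let c : (I × J) →ₗ[R] m := (Submodule.inclusion hI).coprod (Submodule.inclusion hJ)
  have hc : Function.Surjective c := by
    rintro ⟨y, hy⟩
    rw [← hsup] at hy
    obtain ⟨i, hi, j, hj, rfl⟩ := Submodule.mem_sup.mp hy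
    exact ⟨(⟨i, hi⟩, ⟨j, hj⟩), rfl⟩
  obtain ⟨p, hp⟩ := LinearMap.exists_comp_eq_of_ker_le c hc (LinearMap.snd R I J) (by
    rintro ⟨i, j⟩ h
    have h : (i : R) + j = 0 := congrArg Subtype.val h
    have : (j : R) ∈ I ⊓ J := ⟨by rw [eq_neg_of_add_eq_zero_right h]; exact neg_mem i.2, j.2⟩
    rw [hinf] at this
    exact Subtype.ext this)
  refine ⟨p, fun j hj ↦ ?_⟩
  have hcj : c (0, j) = ⟨j, hj⟩ := by
    ext
    simp [c]
  rw [← hcj, hp, LinearMap.snd_apply]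

section Local

variable {R : Type u} [CommRing R] [IsLocalRing R]

/-- A finite module over a local ring is the quotient of a finite free module by a submodule
of `m` times that free module. -/
lemma exists_minimal_cover (M : Type u) [AddCommGroup M] [Module R M] [Module.Finite R M] :
    ∃ (k : ℕ) (f : (Fin k → R) →ₗ[R] M), Function.Surjective f ∧
      ∀ v, f v = 0 → ∀ i, v i ∈ maximalIdeal R := by
  classical
  have hex : ∃ k : ℕ, ∃ g : Fin k → M, Submodule.span R (Set.range g) = ⊤ := by
    obtain ⟨k, g, hg⟩ := Module.Finite.exists_fin (R := R) (M := M)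
    exact ⟨k, g, hg⟩
  obtain ⟨g, hg⟩ := Nat.find_spec hex
  have hmin := fun k hk ↦ Nat.find_min (m := k) hex hk
  generalize Nat.find hex = k at g hg hmin
  refine ⟨k, Fintype.linearCombination R g, ?_, fun v hv i ↦ ?_⟩
  · rw [← LinearMap.range_eq_top, Fintype.range_linearCombination, hg]
  by_contra hi
  rw [mem_maximalIdeal, mem_nonunits_iff, not_not] at hi
  obtain _ | k := k
  · exact i.elim0
  refine hmin k (by omega) ⟨g ∘ i.succAbove, ?_⟩
  rw [eq_top_iff, ← hg, Submodule.span_le]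
  rintro _ ⟨j, rfl⟩
  rcases Fin.eq_self_or_eq_succAbove i j with rfl | ⟨j, rfl⟩
  · rw [Fintype.linearCombination_apply, Fin.sum_univ_succAbove _ j] at hv
    have : v j • g j ∈ Submodule.span R (Set.range (g ∘ j.succAbove)) := by
      rw [eq_neg_of_add_eq_zero_left hv]
      exact neg_mem (sum_mem fun l _ ↦ Submodule.smul_mem _ _ (Submodule.subset_span ⟨l, rfl⟩))
    exact (Submodule.smul_mem_iff_of_isUnit _ hi).mp this
  · exact Submodule.subset_span ⟨j, rfl⟩

/-- Over a Noetherian local ring of depth zero, finite projective dimension forces freeness. -/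
lemma PDLE.projective_of_socle [IsNoetherianRing R] {s : R} (hs : s ≠ 0)
    (hsm : ∀ r ∈ maximalIdeal R, s * r = 0) {M : Type u} [AddCommGroup M] [Module R M]
    [Module.Finite R M] {n : ℕ} (h : PDLE R M n) : Module.Projective R M := by
  induction n generalizing M with
  | zero => exact pdLE_zero_iff.mp h
  | succ n ih =>
    obtain ⟨k, f, hf, hk⟩ := exists_minimal_cover (R := R) M
    have hproj : Module.Projective R (LinearMap.ker f) := ih ((pdLE_succ_iff f hf n).mp h)
    have : Module.Free R (LinearMap.ker f) := Module.free_of_flat_of_isLocalRing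
    have hinj : Function.Injective f := by
      rw [← LinearMap.ker_eq_bot, ← Submodule.subsingleton_iff_eq_bot]
      by_contra hn
      rw [not_subsingleton_iff_nontrivial] at hn
      refine hs ?_
      have : s ∈ Module.annihilator R (LinearMap.ker f) := by
        rw [Module.mem_annihilator]
        rintro ⟨v, hv⟩
        ext i
        exact hsm _ (hk v hv i)
      rwa [Module.annihilator_eq_bot.mpr inferInstance] at this
    exact Module.Projective.of_equiv (LinearEquiv.ofBijective f ⟨hinj, hf⟩)

lemma eq_bot_of_projective_of_mul_eq_bot {I J : Ideal R} (hI : I ≠ ⊥)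
    (hIJ : ∀ j ∈ J, ∀ i ∈ I, j * i = 0) [Module.Finite R I] [Module.Projective R I] : J = ⊥ := by
  have : Module.Free R I := Module.free_of_flat_of_isLocalRing
  have : Nontrivial I := Submodule.nontrivial_iff_ne_bot.mpr hI
  rw [eq_bot_iff, ← Module.annihilator_eq_bot (R := R) (M := I) |>.mpr inferInstance]
  intro j hj
  rw [Module.mem_annihilator]
  rintro ⟨i, hi⟩
  ext
  exact hIJ j hj i hi

/-- The two summands of a nontrivial decomposition of the maximal ideal have infinite projective
dimension: each is a direct summand of the first syzygy of the other. -/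
lemma not_pdLE_of_maximalIdeal_decomposition [IsNoetherianRing R] {I J : Ideal R}
    (hsup : I ⊔ J = maximalIdeal R) (hinf : I ⊓ J = ⊥) (hI : I ≠ ⊥) (hJ : J ≠ ⊥) (n : ℕ) :
    ¬ PDLE R I n := by
  have hIJ : ∀ j ∈ J, ∀ i ∈ I, j * i = 0 := fun j hj i hi ↦ by
    have : j * i ∈ I ⊓ J := ⟨I.mul_mem_left _ hi, J.mul_mem_right _ hj⟩
    rwa [hinf] at this
  induction n generalizing I J with
  | zero =>
    intro h
    have := pdLE_zero_iff.mp h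
    exact hJ (eq_bot_of_projective_of_mul_eq_bot hI hIJ)
  | succ n ih =>
    intro h
    obtain ⟨k, f, hf, hk⟩ := exists_minimal_cover (R := R) I
    rw [pdLE_succ_iff f hf] at h
    refine ih (by rwa [sup_comm]) (by rwa [inf_comm]) hJ hI
      (fun i hi j hj ↦ by rw [mul_comm]; exact hIJ j hj i hi) ?_
    obtain ⟨p, hp⟩ := exists_projection hsup hinf
    have hk0 : Nonempty (Fin k) := by
      by_contra hne
      rw [not_nonempty_iff] at hne
      refine hI (Submodule.subsingleton_iff_eq_bot.mp hf.subsingleton)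
    obtain ⟨l⟩ := hk0
    refine h.of_retract
      (((LinearMap.single R (fun _ ↦ R) l).comp J.subtype).codRestrict _ fun j ↦ ?_)
      (p ∘ₗ (((LinearMap.proj l).comp (LinearMap.ker f).subtype).codRestrict _
        fun v ↦ hk v.1 v.2 l)) fun j ↦ ?_
    · have : Pi.single l (j : R) = (j : R) • (Pi.single l 1 : Fin k → R) := by
        rw [← Pi.single_smul, smul_eq_mul, mul_one]
      rw [LinearMap.mem_ker, LinearMap.comp_apply, LinearMap.single_apply, Submodule.subtype_apply,
        this, map_smul]
      exact Subtype.ext (hIJ j j.2 _ (f _).2)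
    · have hj : (j : R) ∈ maximalIdeal R := hsup ▸ Ideal.mem_sup_right j.2
      refine (congrArg p (Subtype.ext ?_)).trans (hp j hj)
      exact Pi.single_eq_same (M := fun _ ↦ R) l (j : R)

/-- If `x` is a regular element outside the square of the maximal ideal, then the maximal ideal
of `R / x` has projective dimension at most that of the maximal ideal of `R`. -/
lemma PDLE.maximalIdeal_quotient {x : R} (hxR : IsSMulRegular R x) (hx : x ∈ maximalIdeal R)
    (hx2 : x ∉ maximalIdeal R ^ 2) [IsLocalRing (R ⧸ Ideal.span {x})] {n : ℕ}
    (h : PDLE R (maximalIdeal R) n) :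
    PDLE (R ⧸ Ideal.span {x}) (maximalIdeal (R ⧸ Ideal.span {x})) n := by
  let A := R ⧸ Ideal.span {x}
  have hA : Function.Surjective (algebraMap R A) := Ideal.Quotient.mk_surjective
  have hxA : ∀ r, algebraMap R A r = 0 ↔ ∃ s, r = x * s := fun r ↦
    Ideal.Quotient.eq_zero_iff_mem.trans Ideal.mem_span_singleton
  let N := maximalIdeal R ⧸ (Ideal.span {x} • (⊤ : Submodule R (maximalIdeal R)))
  let q : maximalIdeal R →ₗ[R] N := Submodule.mkQ _
  have hq : Function.Surjective q := Submodule.mkQ_surjective _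
  have hqx : ∀ m, q m = 0 ↔ ∃ m', m = x • m' := fun m ↦ by
    rw [Submodule.mkQ_apply, Submodule.Quotient.mk_eq_zero, Submodule.ideal_span_singleton_smul,
      Submodule.mem_smul_pointwise_iff_exists]
    simp [eq_comm]
  have hN : PDLE A N n := h.of_quotient_regular hA x hxA hxR q hq hqx
    (fun v w hvw ↦ Subtype.ext (hxR (congrArg Subtype.val hvw)))
  have hloc : IsLocalHom (algebraMap R A) := .of_surjective _ hA
  let ρ : maximalIdeal R →ₗ[R] maximalIdeal A :=
    { toFun := fun y ↦ ⟨algebraMap R A y, map_nonunit (algebraMap R A) _ y.2⟩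
      map_add' := fun y z ↦ Subtype.ext (map_add (algebraMap R A) _ _)
      map_smul' := fun r y ↦ Subtype.ext (map_mul (algebraMap R A) _ _) }
  have hρ : Function.Surjective ρ := by
    rintro ⟨a, ha⟩
    obtain ⟨r, rfl⟩ := hA a
    exact ⟨⟨r, fun hr ↦ ha (hr.map (algebraMap R A))⟩, rfl⟩
  let X : maximalIdeal R := ⟨x, hx⟩
  have hρX : ρ X = 0 := Subtype.ext ((hxA x).mpr ⟨1, (mul_one x).symm⟩)
  obtain ⟨δ, hδ⟩ := Module.Projective.exists_dual_eq_one (ResidueField R)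
    (x := (maximalIdeal R).toCotangent X) (by rwa [ne_eq, Ideal.toCotangent_eq_zero])
  let φ : maximalIdeal R →ₗ[R] ResidueField R :=
    (δ.restrictScalars R) ∘ₗ (maximalIdeal R).toCotangent
  have hφX : φ X = 1 := hδ
  obtain ⟨ε, hε⟩ := LinearMap.exists_comp_eq_of_ker_le (Algebra.linearMap R (ResidueField R))
    residue_surjective (LinearMap.toSpanSingleton R N (q X)) (fun r hr ↦ by
      have hr : r ∈ maximalIdeal R := (residue_eq_zero_iff r).mp hr
      rw [LinearMap.toSpanSingleton_apply, ← map_smul, hqx]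
      exact ⟨⟨r, hr⟩, Subtype.ext (mul_comm r x)⟩)
  obtain ⟨p, hp⟩ := LinearMap.exists_comp_eq_of_ker_le q hq ρ (fun y hy ↦ by
    obtain ⟨z, rfl⟩ := (hqx y).mp hy
    exact Subtype.ext ((hxA _).mpr ⟨z, rfl⟩))
  have hpε : ∀ c, p (ε c) = 0 := fun c ↦ by
    obtain ⟨r, rfl⟩ := residue_surjective c
    change p (ε (Algebra.linearMap R (ResidueField R) r)) = 0
    rw [hε, LinearMap.toSpanSingleton_apply, map_smul, hp, hρX, smul_zero]
  obtain ⟨i, hi⟩ := LinearMap.exists_comp_eq_of_ker_le ρ hρ (q - ε ∘ₗ φ) (fun y hy ↦ by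
    obtain ⟨s, hs⟩ := (hxA y).mp (congrArg Subtype.val hy)
    obtain rfl : y = s • X := Subtype.ext (hs.trans (mul_comm x s))
    have h1 : ε 1 = q X := by simpa using hε 1
    rw [map_smul, LinearMap.sub_apply, LinearMap.comp_apply, hφX, h1, sub_self, smul_zero])
  refine hN.of_retract (i.extendScalarsOfSurjective hA) (p.extendScalarsOfSurjective hA)
    fun y ↦ ?_
  obtain ⟨y, rfl⟩ := hρ y
  change p (i (ρ y)) = ρ y
  rw [hi, LinearMap.sub_apply, map_sub, LinearMap.comp_apply, hpε, hp, sub_zero]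

lemma isGeneratedByRegularSequence_bot (R : Type*) [CommRing R] [IsLocalRing R] :
    IsGeneratedByRegularSequence R ⊥ :=
  ⟨[], by simp, .nil R R, by simp⟩

lemma IsGeneratedByRegularSequence.of_quotient {x : R} (hxR : IsSMulRegular R x)
    (hx : x ∈ maximalIdeal R) [IsLocalRing (R ⧸ Ideal.span {x})]
    (h : IsGeneratedByRegularSequence (R ⧸ Ideal.span {x}) (maximalIdeal _)) :
    IsGeneratedByRegularSequence R (maximalIdeal R) := by
  obtain ⟨rs', hmem, hreg, hspan⟩ := h
  have hA : Function.Surjective (algebraMap R (R ⧸ Ideal.span {x})) :=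
    Ideal.Quotient.mk_surjective
  have hloc : IsLocalHom (algebraMap R (R ⧸ Ideal.span {x})) := .of_surjective _ hA
  obtain ⟨rs, rfl⟩ : ∃ rs : List R, rs.map (algebraMap R (R ⧸ Ideal.span {x})) = rs' :=
    List.map_surjective_iff.mpr hA rs'
  have hrs : ∀ y ∈ x :: rs, y ∈ maximalIdeal R := by
    rintro y (_ | ⟨_, hy⟩)
    · exact hx
    · exact fun hu ↦ hmem _ (List.mem_map_of_mem hy) (hu.map _)
  refine ⟨x :: rs, hrs, ?_, le_antisymm (Ideal.span_le.mpr hrs) fun y hy ↦ ?_⟩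
  · rw [RingTheory.Sequence.isWeaklyRegular_cons_iff]
    refine ⟨hxR, ?_⟩
    rw [RingTheory.Sequence.isWeaklyRegular_map_algebraMap_iff] at hreg
    refine ((Submodule.quotEquivOfEq _ _ ?_).isWeaklyRegular_congr rs).mpr hreg
    rw [← Submodule.ideal_span_singleton_smul, smul_eq_mul, Ideal.mul_top]
  · have hy' : algebraMap R (R ⧸ Ideal.span {x}) y ∈ maximalIdeal (R ⧸ Ideal.span {x}) :=
      map_nonunit _ _ hy
    have himg : {a | a ∈ rs.map (algebraMap R (R ⧸ Ideal.span {x}))} =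
        algebraMap R (R ⧸ Ideal.span {x}) '' {a | a ∈ rs} := by
      ext a; simp
    rw [← hspan, himg, ← Ideal.map_span, Ideal.mem_map_iff_of_surjective _ hA] at hy'
    obtain ⟨z, hz, hzy⟩ := hy'
    have hyz : y - z ∈ Ideal.span {x} := (Ideal.Quotient.eq).mp hzy.symm
    rw [← sub_add_cancel y z]
    exact add_mem (Ideal.span_mono (by simp) hyz) (Ideal.span_mono (fun a ha ↦ by
      exact List.mem_cons_of_mem x ha) hz)

/-- If the maximal ideal has finite projective dimension and is nonzero, then it contains a
regular element outside its square. -/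
lemma PDLE.exists_regular [IsNoetherianRing R] (hm : maximalIdeal R ≠ ⊥) {n : ℕ}
    (h : PDLE R (maximalIdeal R) n) :
    ∃ x ∈ maximalIdeal R, x ∉ maximalIdeal R ^ 2 ∧ IsSMulRegular R x := by
  by_contra! hcon
  have hsub : (maximalIdeal R : Set R) ⊆
      ⋃ I ∈ insert (maximalIdeal R ^ 2) (associatedPrimes R R), ((id I : Ideal R) : Set R) := by
    intro x hx
    rw [Set.biUnion_insert]
    by_cases hx2 : x ∈ maximalIdeal R ^ 2
    · exact Or.inl hx2
    · right
      simp_rw [id, biUnion_associatedPrimes_eq_compl_nonZeroDivisors]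
      intro hx0
      refine hcon x hx hx2 ?_
      exact (isSMulRegular_iff_right_eq_zero_of_smul).mpr fun r hr ↦
        (mul_left_mem_nonZeroDivisors_eq_zero_iff hx0).mp hr
  rw [Ideal.subset_union_prime_finite ((associatedPrimes.finite R R).insert _)
    (maximalIdeal R ^ 2) (maximalIdeal R ^ 2)] at hsub
  · obtain ⟨I, rfl | hI, hle⟩ := hsub
    · have hid : IsIdempotentElem (maximalIdeal R) :=
        le_antisymm Ideal.mul_le_left (by simpa [sq] using hle)
      exact hm (Submodule.eq_bot_of_le_smul_of_le_jacobson_bot _ _ (IsNoetherian.noetherian _)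
        hid.ge (maximalIdeal_le_jacobson _))
    · have := ((AssociatedPrimes.mem_iff).mp hI).1
      rw [AssociatedPrimes.mem_iff, isAssociatedPrime_iff] at hI
      obtain ⟨hprime, s, rfl⟩ := hI
      have hsm : ∀ r ∈ maximalIdeal R, s * r = 0 := fun r hr ↦ by
        simpa [Submodule.mem_colon_singleton, mul_comm] using hle hr
      have hs : s ≠ 0 := by
        rintro rfl
        exact hprime.ne_top (by simp [Ideal.eq_top_iff_one, Submodule.mem_colon_singleton])
      have := h.projective_of_socle hs hsm
      refine hs ((Ideal.span_singleton_eq_bot).mp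
        (eq_bot_of_projective_of_mul_eq_bot hm fun j hj i hi ↦ ?_))
      obtain ⟨c, rfl⟩ := Ideal.mem_span_singleton.mp hj
      rw [mul_right_comm, hsm i hi, zero_mul]
  · rintro I (rfl | hI) hne -
    · exact absurd rfl hne
    · exact hI.1

end Local

/-- If the maximal ideal of a Noetherian local ring has finite projective dimension, then it is
generated by a regular sequence. -/
lemma PDLE.isGeneratedByRegularSequence_maximalIdeal (d : ℕ) (R : Type u) [CommRing R]
    [IsLocalRing R] [IsNoetherianRing R] (g : Fin d → R)
    (hg : Ideal.span (Set.range g) = maximalIdeal R) {n : ℕ} (h : PDLE R (maximalIdeal R) n) :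
    IsGeneratedByRegularSequence R (maximalIdeal R) := by
  induction d generalizing R with
  | zero =>
    rw [← hg]
    simpa using isGeneratedByRegularSequence_bot R
  | succ d ih =>
    by_cases hm : maximalIdeal R = ⊥
    · rw [hm]
      exact isGeneratedByRegularSequence_bot R
    obtain ⟨x, hx, hx2, hxR⟩ := h.exists_regular hm
    have : Nontrivial (R ⧸ Ideal.span {x}) :=
      Ideal.Quotient.nontrivial_iff.mpr fun htop ↦ hx ((Ideal.span_singleton_eq_top).mp htop)
    have hA : Function.Surjective (algebraMap R (R ⧸ Ideal.span {x})) :=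
      Ideal.Quotient.mk_surjective
    have : IsLocalRing (R ⧸ Ideal.span {x}) := .of_surjective' _ hA
    have hloc : IsLocalHom (algebraMap R (R ⧸ Ideal.span {x})) := .of_surjective _ hA
    have hgm : ∀ i, g i ∈ maximalIdeal R := fun i ↦ hg ▸ Ideal.subset_span ⟨i, rfl⟩
    obtain ⟨c, hc⟩ := (Ideal.mem_span_range_iff_exists_fun).mp (hg ▸ hx)
    obtain ⟨i, hi⟩ : ∃ i, IsUnit (c i) := by
      by_contra! hnu
      refine hx2 (hc ▸ sum_mem fun i _ ↦ ?_)
      rw [sq]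
      exact Ideal.mul_mem_mul (hnu i) (hgm i)
    refine .of_quotient hxR hx (ih (R ⧸ Ideal.span {x})
      (algebraMap R (R ⧸ Ideal.span {x}) ∘ g ∘ i.succAbove) (le_antisymm ?_ ?_)
      (h.maximalIdeal_quotient hxR hx hx2))
    · rw [Ideal.span_le]
      rintro _ ⟨j, rfl⟩
      exact map_nonunit _ _ (hgm _)
    · intro a ha
      obtain ⟨r, rfl⟩ := hA a
      have hr : r ∈ maximalIdeal R := fun hr ↦ ha (hr.map _)
      have hle : maximalIdeal R ≤ (Ideal.span (Set.range
          (algebraMap R (R ⧸ Ideal.span {x}) ∘ g ∘ i.succAbove))).comap (algebraMap R _) := by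
        rw [← hg, Ideal.span_le]
        have hs : ∀ j, algebraMap R (R ⧸ Ideal.span {x}) (g (i.succAbove j)) ∈ Ideal.span
            (Set.range (algebraMap R (R ⧸ Ideal.span {x}) ∘ g ∘ i.succAbove)) :=
          fun j ↦ Ideal.subset_span ⟨j, rfl⟩
        rintro _ ⟨j, rfl⟩
        rcases Fin.eq_self_or_eq_succAbove i j with rfl | ⟨j, rfl⟩
        · have hx0 : algebraMap R (R ⧸ Ideal.span {x}) (∑ i, c i * g i) = 0 :=
            Ideal.Quotient.eq_zero_iff_mem.mpr (hc ▸ Ideal.mem_span_singleton_self x)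
          rw [Fin.sum_univ_succAbove _ j, map_add, map_mul, map_sum] at hx0
          refine Ideal.mem_comap.mpr ((Ideal.unit_mul_mem_iff_mem _
            (hi.map (algebraMap R (R ⧸ Ideal.span {x})))).mp ?_)
          rw [eq_neg_of_add_eq_zero_left hx0]
          refine neg_mem (sum_mem fun l _ ↦ ?_)
          rw [map_mul]
          exact Ideal.mul_mem_left _ _ (hs l)
        · exact hs j
      exact hle hr


/-- If `(R, m, k)` is a commutative Noetherian local ring whose maximal ideal decomposes
as an internal direct sum `m = I ⊕ J` of ideals, where `I` is nonzero and not generated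
by any `R`-regular sequence, then `R/I` has infinite projective dimension over `R`. -/
theorem stmt4 (R : Type*) [CommRing R] [IsLocalRing R] [IsNoetherianRing R]
    (I J : Ideal R) (hsup : I ⊔ J = maximalIdeal R) (hinf : I ⊓ J = ⊥)
    (hI : I ≠ ⊥) (hreg : ¬ IsGeneratedByRegularSequence R I) :
    ¬ HasFiniteProjDim R (R ⧸ I) := by
  intro hfin
  obtain ⟨n, hn⟩ := hfin.exists_pdLE
  have hn : PDLE R I n := by
    have := (pdLE_succ_iff I.mkQ (Submodule.mkQ_surjective _) n).mp hn.succ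
    rwa [Submodule.ker_mkQ] at this
  by_cases hJ : J = ⊥
  · obtain rfl : I = maximalIdeal R := by rw [← hsup, hJ, sup_bot_eq]
    obtain ⟨d, g, hg⟩ := Submodule.fg_iff_exists_fin_generating_family.mp
      (IsNoetherian.noetherian (maximalIdeal R))
    exact hreg (hn.isGeneratedByRegularSequence_maximalIdeal d R g hg)
  · exact not_pdLE_of_maximalIdeal_decomposition hsup hinf hI hJ n hn
end
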